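/- There exists a planar graph containing no cycle of length 4 and no cycle of length 5 that is not (3,2)-choosable. -/

import Mathlib

open Set

namespace ChoosSep

/-- `G` has a cycle of length `n`. -/
def HasCycleLen {V : Type} (G : SimpleGraph V) (n : ℕ) : Prop :=
  ∃ (v : V) (c : G.Walk v v), c.IsCycle ∧ c.length = n

/-- `G` has a proper coloring choosing each color from the list `L v`. -/
def ColorableWith {V : Type} (G : SimpleGraph V) (L : V → Finset ℕ) : Prop :=
  ∃ φ : V → ℕ, (∀ v, φ v ∈ L v) ∧ ∀ ⦃u v⦄, G.Adj u v → φ u ≠ φ v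

/-- `G` is `(k,d)`-choosable: it has an `L`-coloring for every list assignment
giving each vertex at least `k` colors and any two adjacent vertices at most `d`
common colors. -/
def Choosable {V : Type} (G : SimpleGraph V) (k d : ℕ) : Prop :=
  ∀ L : V → Finset ℕ, (∀ v, k ≤ (L v).card) →
    (∀ ⦃u v⦄, G.Adj u v → ((L u) ∩ (L v)).card ≤ d) →
    ColorableWith G L

/-- The closed straight segment between two points of the plane. -/
def seg (x y : ℝ × ℝ) : Set (ℝ × ℝ) := segment ℝ x y

/-- A straight-line plane embedding of `G`: vertices go to distinct points, edges are
drawn as straight segments, two distinct edges meet only in common endpoints, and no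
vertex lies on the drawing of an edge it does not belong to.  By Fáry's theorem a
finite simple graph admits such an embedding iff it is planar. -/
structure PlaneEmb {V : Type} (G : SimpleGraph V) where
  pos : V → ℝ × ℝ
  inj : Function.Injective pos
  edges_meet : ∀ ⦃a b c d : V⦄, G.Adj a b → G.Adj c d → s(a, b) ≠ s(c, d) →
    seg (pos a) (pos b) ∩ seg (pos c) (pos d) ⊆ ({pos a, pos b} ∩ {pos c, pos d} : Set (ℝ × ℝ))
  vertex_off : ∀ ⦃a b v : V⦄, G.Adj a b → v ≠ a → v ≠ b → pos v ∉ seg (pos a) (pos b)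

/-- `G` is planar: it admits a plane embedding. -/
def IsPlanar {V : Type} (G : SimpleGraph V) : Prop := Nonempty (PlaneEmb G)

/-! ### The graph

Two poles, with roles `0` and `1`, are joined by nine copies of a gadget whose eighteen inner vertices
have the roles `2, …, 19`.  In a list coloring, the colors of the poles determine a gadget in which the
vertices with roles `4, 7, 8, 9, 10, 13, 16` are forced one after the other, and the triangle
`17, 18, 19` then cannot be colored. -/

/-- Adjacency of the roles in a gadget together with the two poles. -/
def roleNbr (j : ℕ) : List ℕ :=
  [[2, 5, 11, 14], [3, 6], [0, 3, 4], [1, 2, 4], [2, 3, 8, 9], [0, 6, 7], [1, 5, 7], [5, 6, 8, 10],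
    [4, 7, 9, 10, 18], [4, 8, 12], [7, 8, 15], [0, 12, 13], [9, 11, 13], [11, 12, 17], [0, 15, 16],
    [10, 14, 16], [14, 15, 19], [13, 18, 19], [8, 17, 19], [16, 17, 18]].getD j []

/-- The vertex playing role `j` in gadget `i`. -/
def vert (i j : ℕ) : ℕ := if j < 2 then j else 18 * i + j

/-- The gadget containing the vertex `p`. -/
def gadget (p : ℕ) : ℕ := (p - 2) / 18

/-- The role of the vertex `p` in its gadget. -/
def role (p : ℕ) : ℕ := if p < 2 then p else (p - 2) % 18 + 2

/-- The neighbors of the vertex `p`. -/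
def nbr (p : ℕ) : List ℕ :=
  if p < 2 then (List.range 9).flatMap fun i => (roleNbr p).map (vert i)
  else (roleNbr (role p)).map (vert (gadget p))

/-- Nine gadgets glued along the two poles. -/
def gadgetGraph : SimpleGraph (Fin 164) where
  Adj p q := q.val ∈ nbr p.val
  symm := ⟨by
    have h : ∀ p < 164, ∀ q ∈ nbr p, p ∈ nbr q := by decide +kernel
    exact fun p q hpq => h p p.isLt q hpq⟩
  loopless := ⟨by
    have h : ∀ p < 164, p ∉ nbr p := by decide +kernel
    exact fun p => h p p.isLt⟩

/-! ### Short cycles -/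

theorem no_four_cycle_of_min : ∀ a < 164, ∀ b ∈ nbr a, a < b → ∀ c ∈ nbr b, a < c →
    ∀ d ∈ nbr c, a < d → d ≠ b → a ∉ nbr d := by
  decide +kernel

theorem not_hasCycleLen_four : ¬ HasCycleLen gadgetGraph 4 := by
  rintro ⟨a, c, hc, hlen⟩
  match c, hc, hlen with
  | .cons (v := b) hab (.cons (v := c) hbc (.cons (v := d) hcd (.cons hda .nil))), hc, _ =>
    have hn := hc.support_nodup
    simp only [SimpleGraph.Walk.support_cons, SimpleGraph.Walk.support_nil, List.tail_cons,
      List.nodup_cons, List.mem_cons, List.not_mem_nil, or_false, not_or, Fin.ext_iff] at hn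
    have key {a b c d : Fin 164} (hab : gadgetGraph.Adj a b) (hbc : gadgetGraph.Adj b c)
        (hcd : gadgetGraph.Adj c d) (hda : gadgetGraph.Adj d a) :
        ¬ (a.val < b ∧ a.val < c ∧ a.val < d ∧ d.val ≠ b) :=
      fun h => no_four_cycle_of_min a a.isLt b hab h.1 c hbc h.2.1 d hcd h.2.2.1 h.2.2.2 hda
    have := key hab hbc hcd hda
    have := key hbc hcd hda hab
    have := key hcd hda hab hbc
    have := key hda hab hbc hcd
    omega

set_option synthInstance.maxSize 1000 in
theorem no_five_cycle_of_min : ∀ a < 164, ∀ b ∈ nbr a, a < b → ∀ c ∈ nbr b, a < c →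
    ∀ d ∈ nbr c, a < d → d ≠ b → ∀ e ∈ nbr d, a < e ∧ e ≠ b ∧ e ≠ c → a ∉ nbr e := by
  decide +kernel

theorem not_hasCycleLen_five : ¬ HasCycleLen gadgetGraph 5 := by
  rintro ⟨a, c, hc, hlen⟩
  match c, hc, hlen with
  | .cons (v := b) hab (.cons (v := c) hbc (.cons (v := d) hcd
      (.cons (v := e) hde (.cons hea .nil)))), hc, _ =>
    have hn := hc.support_nodup
    simp only [SimpleGraph.Walk.support_cons, SimpleGraph.Walk.support_nil, List.tail_cons,
      List.nodup_cons, List.mem_cons, List.not_mem_nil, or_false, not_or, Fin.ext_iff] at hn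
    have key {a b c d e : Fin 164} (hab : gadgetGraph.Adj a b) (hbc : gadgetGraph.Adj b c)
        (hcd : gadgetGraph.Adj c d) (hde : gadgetGraph.Adj d e) (hea : gadgetGraph.Adj e a) :
        ¬ (a.val < b ∧ a.val < c ∧ a.val < d ∧ d.val ≠ b ∧ a.val < e ∧ e.val ≠ b ∧ e.val ≠ c) :=
      fun h => no_five_cycle_of_min a a.isLt b hab h.1 c hbc h.2.1 d hcd h.2.2.1 h.2.2.2.1 e hde
        h.2.2.2.2 hea
    have := key hab hbc hcd hde hea
    have := key hbc hcd hde hea hab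
    have := key hcd hde hea hab hbc
    have := key hde hea hab hbc hcd
    have := key hea hab hbc hcd hde
    clear key
    grind (splits := 40) only

/-! ### The list assignment -/

/-- The list of role `j` in the gadget responsible for the colors `a` and `b` on the poles. -/
def roleList (a b j : ℕ) : Finset ℕ :=
  [{0, 1, 2}, {3, 4, 5}, {a, 6, 7}, {b, 6, 7}, {6, 7, 8}, {a, 6, 7}, {b, 6, 7}, {6, 7, 9},
    {8, 9, 10}, {8, 10, 11}, {9, 10, 12}, {a, 6, 7}, {6, 7, 11}, {6, 7, 13}, {a, 6, 7},
    {6, 7, 12}, {6, 7, 14}, {13, 15, 16}, {10, 15, 16}, {14, 15, 16}].getD j ∅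

/-- The list of the vertex `p`. -/
def vertList (p : ℕ) : Finset ℕ := roleList (gadget p / 3) (3 + gadget p % 3) (role p)

theorem forced_of_triangle {a b m n k x y z : ℕ} (hx : x ∈ ({a, m, n} : Finset ℕ))
    (hy : y ∈ ({b, m, n} : Finset ℕ)) (hz : z ∈ ({m, n, k} : Finset ℕ)) (hxa : x ≠ a) (hyb : y ≠ b)
    (hxy : x ≠ y) (hxz : x ≠ z) (hyz : y ≠ z) : z = k := by
  simp only [Finset.mem_insert, Finset.mem_singleton] at hx hy hz
  grind

theorem forced_of_two {a b k x : ℕ} (hx : x ∈ ({a, b, k} : Finset ℕ)) (hxa : x ≠ a) (hxb : x ≠ b) :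
    x = k := by
  simpa [hxa, hxb] using hx

theorem role_not_colorable (c : ℕ → ℕ) (hmem : ∀ j < 20, c j ∈ roleList (c 0) (c 1) j)
    (hne : ∀ j < 20, ∀ k ∈ roleNbr j, c j ≠ c k) : False := by
  have ne (j k : ℕ) (hj : j < 20 := by decide) (hk : k ∈ roleNbr j := by decide) : c j ≠ c k :=
    hne j hj k hk
  have mem (j : ℕ) (hj : j < 20 := by decide) := hmem j hj
  have h4 : c 4 = 8 := forced_of_triangle (mem 2) (mem 3) (mem 4) (ne 2 0) (ne 3 1) (ne 2 3)
    (ne 2 4) (ne 3 4)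
  have h7 : c 7 = 9 := forced_of_triangle (mem 5) (mem 6) (mem 7) (ne 5 0) (ne 6 1) (ne 5 6)
    (ne 5 7) (ne 6 7)
  have h8 : c 8 = 10 := forced_of_two (mem 8) (h4 ▸ ne 8 4) (h7 ▸ ne 8 7)
  have h9 : c 9 = 11 := forced_of_two (mem 9) (h4 ▸ ne 9 4) (h8 ▸ ne 9 8)
  have h10 : c 10 = 12 := forced_of_two (mem 10) (h7 ▸ ne 10 7) (h8 ▸ ne 10 8)
  have h13 : c 13 = 13 := by
    refine forced_of_triangle (mem 11) (b := 11) ?_ (mem 13) (ne 11 0) (h9 ▸ ne 12 9) (ne 11 12)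
      (ne 11 13) (ne 12 13)
    have := mem 12
    simp [roleList] at this ⊢
    tauto
  have h16 : c 16 = 14 := by
    refine forced_of_triangle (mem 14) (b := 12) ?_ (mem 16) (ne 14 0) (h10 ▸ ne 15 10) (ne 14 15)
      (ne 14 16) (ne 15 16)
    have := mem 15
    simp [roleList] at this ⊢
    tauto
  have h19 : c 19 = 14 := by
    refine forced_of_triangle (mem 17) (mem 18) ?_ (h13 ▸ ne 17 13) (h8 ▸ ne 18 8) (ne 17 18)
      (ne 17 19) (ne 18 19)
    have := mem 19
    simp [roleList] at this ⊢
    tauto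
  exact absurd (h19.trans h16.symm) (ne 19 16)

theorem not_choosable : ¬ Choosable gadgetGraph 3 2 := by
  intro h
  have hcard : ∀ p < 164, 3 ≤ (vertList p).card := by decide +kernel
  have hinter : ∀ p < 164, ∀ q ∈ nbr p, (vertList p ∩ vertList q).card ≤ 2 := by decide +kernel
  obtain ⟨φ, hφ, hadj⟩ := h (fun p => vertList p) (fun p => hcard p p.isLt)
    fun p q hpq => hinter p p.isLt q hpq
  have h0 : φ 0 ∈ ({0, 1, 2} : Finset ℕ) := hφ 0
  have h1 : φ 1 ∈ ({3, 4, 5} : Finset ℕ) := hφ 1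
  simp only [Finset.mem_insert, Finset.mem_singleton] at h0 h1
  obtain ⟨i, hi, hi0, hi1⟩ : ∃ i < 9, i / 3 = φ 0 ∧ 3 + i % 3 = φ 1 :=
    ⟨3 * φ 0 + (φ 1 - 3), by omega, by omega, by omega⟩
  have hvert : ∀ i < 9, ∀ j < 20, vert i j < 164 := by decide +kernel
  have hlist : ∀ i < 9, ∀ j < 20, vertList (vert i j) = roleList (i / 3) (3 + i % 3) j := by
    decide +kernel
  have hnbr : ∀ i < 9, ∀ j < 20, ∀ k ∈ roleNbr j, k < 20 ∧ vert i k ∈ nbr (vert i j) := by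
    decide +kernel
  have hcast (j : ℕ) (hj : j < 20) : ((Fin.ofNat 164 (vert i j) : Fin 164) : ℕ) = vert i j :=
    Nat.mod_eq_of_lt (hvert i hi j hj)
  refine role_not_colorable (fun j => φ (Fin.ofNat 164 (vert i j))) (fun j hj => ?_)
    fun j hj k hk => hadj ?_
  · have : _ ∈ vertList _ := hφ (Fin.ofNat 164 (vert i j))
    rw [hcast j hj, hlist i hi j hj, hi0, hi1] at this
    exact this
  · obtain ⟨hk20, hjk⟩ := hnbr i hi j hj k hk
    change _ ∈ nbr _
    rwa [hcast j hj, hcast k hk20]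

/-! ### Planarity -/

/-- Twice the signed area of the triangle `a b c`. -/
def orient {R : Type} [Ring R] (a b c : R × R) : R :=
  (b.1 - a.1) * (c.2 - a.2) - (b.2 - a.2) * (c.1 - a.1)

theorem orient_eq_zero_of_mem_seg {a b x : ℝ × ℝ} (hx : x ∈ seg a b) : orient a b x = 0 := by
  obtain ⟨s, t, -, -, hst, rfl⟩ := hx
  obtain rfl : s = 1 - t := by linarith
  simp [orient]
  ring

theorem seg_inter_eq_empty {a b c d : ℝ × ℝ} (h : 0 < orient a b c * orient a b d) :
    seg a b ∩ seg c d = ∅ := by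
  rw [Set.eq_empty_iff_forall_notMem]
  rintro x ⟨hab, s, t, hs, ht, hst, rfl⟩
  have h0 := orient_eq_zero_of_mem_seg hab
  have hcomb : orient a b (s • c + t • d) = s * orient a b c + t * orient a b d := by
    obtain rfl : s = 1 - t := by linarith
    simp [orient]
    ring
  rw [hcomb] at h0
  rcases pos_and_pos_or_neg_and_neg_of_mul_pos h with ⟨hc, hd⟩ | ⟨hc, hd⟩
  · rcases hs.eq_or_lt with rfl | hs
    · nlinarith
    · nlinarith [mul_pos hs hc, mul_nonneg ht hd.le]
  · rcases hs.eq_or_lt with rfl | hs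
    · nlinarith
    · nlinarith [mul_neg_of_pos_of_neg hs hc, mul_nonpos_of_nonneg_of_nonpos ht hd.le]

theorem seg_inter_subset_singleton {a b c : ℝ × ℝ} (h : orient a b c ≠ 0) :
    seg a b ∩ seg a c ⊆ {a} := by
  rintro x ⟨hab, s, t, -, -, hst, rfl⟩
  have h0 := orient_eq_zero_of_mem_seg hab
  obtain rfl : s = 1 - t := by linarith
  have hcomb : orient a b ((1 - t) • a + t • c) = t * orient a b c := by
    simp [orient]
    ring
  obtain rfl : t = 0 := (mul_eq_zero.1 (hcomb ▸ h0)).resolve_right h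
  simp

theorem seg_comm (a b : ℝ × ℝ) : seg a b = seg b a := segment_symm ℝ a b

/-- The position of the vertex `p` in the drawing. -/
def coord (p : ℕ) : ℤ × ℤ :=
  [(130, 5000), (130, -5000), (0, 8), (0, -8), (1, 2), (20, 8), (20, -8), (19, 2), (10, 1), (6, 3),
    (14, 3), (5, 8), (6, 5), (8, 6), (15, 8), (14, 5), (12, 6), (9, 5), (10, 3),
    (11, 4)].getD (role p) 0 + ((30 * gadget p : ℤ), (0 : ℤ))

/-- A sufficient condition for the drawings of two distinct edges `p q` and `r s` with `p ≤ r`,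
`p < q` and `r < s` to meet only in common endpoints. -/
def MeetOnlyInEnds (p q r s : ℕ) : Prop :=
  0 < orient (coord p) (coord q) (coord r) * orient (coord p) (coord q) (coord s) ∨
  0 < orient (coord r) (coord s) (coord p) * orient (coord r) (coord s) (coord q) ∨
  p = r ∧ orient (coord p) (coord q) (coord s) ≠ 0 ∨
  q = r ∧ orient (coord q) (coord p) (coord s) ≠ 0 ∨
  q = s ∧ orient (coord q) (coord p) (coord r) ≠ 0

instance (p q r s : ℕ) : Decidable (MeetOnlyInEnds p q r s) := by
  unfold MeetOnlyInEnds
  infer_instance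

set_option synthInstance.maxSize 1000 in
theorem meetOnlyInEnds_of_gadget : ∀ i < 9, ∀ j < 20, ∀ j' ∈ roleNbr j, j < j' → ∀ k < 20, j ≤ k →
    ∀ k' ∈ roleNbr k, k < k' → (j = k → j' ≠ k') →
      MeetOnlyInEnds (vert i j) (vert i j') (vert i k) (vert i k') := by
  decide +kernel

theorem meetOnlyInEnds_of_poles : ∀ p < 2, ∀ q ∈ nbr p, ∀ r < 2, p ≤ r → ∀ s ∈ nbr r, q ≠ s →
    MeetOnlyInEnds p q r s := by
  decide +kernel

/-- The point of the plane representing the vertex `p`. -/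
def realCoord (p : ℕ) : ℝ × ℝ := ((coord p).1, (coord p).2)

theorem orient_realCoord (p q r : ℕ) :
    orient (realCoord p) (realCoord q) (realCoord r) =
      (orient (coord p) (coord q) (coord r) : ℤ) := by
  simp [orient, realCoord]

theorem MeetOnlyInEnds.inter_subset {p q r s : ℕ} (h : MeetOnlyInEnds p q r s) :
    seg (realCoord p) (realCoord q) ∩ seg (realCoord r) (realCoord s) ⊆
      ({realCoord p, realCoord q} ∩ {realCoord r, realCoord s} : Set (ℝ × ℝ)) := by
  rcases h with h | h | ⟨rfl, h⟩ | ⟨rfl, h⟩ | ⟨rfl, h⟩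
  · rw [seg_inter_eq_empty (by simp only [orient_realCoord]; exact_mod_cast h)]
    exact Set.empty_subset _
  · rw [Set.inter_comm, seg_inter_eq_empty (by simp only [orient_realCoord]; exact_mod_cast h)]
    exact Set.empty_subset _
  · refine (seg_inter_subset_singleton (by rw [orient_realCoord]; exact_mod_cast h)).trans ?_
    simp
  · rw [seg_comm (realCoord p)]
    refine (seg_inter_subset_singleton (by rw [orient_realCoord]; exact_mod_cast h)).trans ?_
    simp
  · rw [seg_comm (realCoord p), seg_comm (realCoord r)]
    refine (seg_inter_subset_singleton (by rw [orient_realCoord]; exact_mod_cast h)).trans ?_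
    simp

theorem realCoord_injective {p q : ℕ} (hp : p < 164) (hq : q < 164)
    (h : realCoord p = realCoord q) : p = q := by
  have hcoord : coord p = coord q := by simpa [realCoord, Prod.ext_iff] using h
  have hgad : ∀ p < 164, (gadget p : ℤ) = if |(coord p).2| ≤ 8 then (coord p).1 / 30 else 0 := by
    decide +kernel
  have hvert : ∀ q < 164, role q < 20 ∧ vert (gadget q) (role q) = q := by decide +kernel
  have key : ∀ p < 164, ∀ j < 20, coord p = coord (vert (gadget p) j) →
      p = vert (gadget p) j := by decide +kernel
  have hpq : gadget p = gadget q := by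
    exact_mod_cast (hgad p hp).trans (hcoord ▸ (hgad q hq).symm)
  have := key p hp (role q) (hvert q hq).1
  rw [hpq, (hvert q hq).2] at this
  exact this hcoord

theorem eq_vert_of_edge : ∀ p < 164, ∀ q ∈ nbr p, p < q →
    p = vert (gadget q) (role p) ∧ q = vert (gadget q) (role q) ∧ gadget q < 9 ∧ role p < 20 ∧
      role q ∈ roleNbr (role p) ∧ role p < role q ∧ (2 ≤ p → gadget p = gadget q) := by
  decide +kernel

/-- A rectangle containing the inner vertices of gadget `i`. -/
def box (i : ℕ) : Set (ℝ × ℝ) := Icc (30 * i : ℝ) (30 * i + 20) ×ˢ Icc (-8) 8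

theorem eq_of_mem_box {i k : ℕ} {z : ℝ × ℝ} (hi : z ∈ box i) (hk : z ∈ box k) : i = k := by
  obtain ⟨⟨hi₁, hi₂⟩, -⟩ := hi
  obtain ⟨⟨hk₁, hk₂⟩, -⟩ := hk
  have h₁ : 30 * i ≤ 30 * k + 20 := by exact_mod_cast hi₁.trans hk₂
  have h₂ : 30 * k ≤ 30 * i + 20 := by exact_mod_cast hk₁.trans hi₂
  omega

theorem realCoord_mem_box {p : ℕ} (hp : p < 164) (hp2 : 2 ≤ p) : realCoord p ∈ box (gadget p) := by
  have key : ∀ p < 164, 2 ≤ p → (30 * gadget p ≤ (coord p).1 ∧ (coord p).1 ≤ 30 * gadget p + 20) ∧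
      -8 ≤ (coord p).2 ∧ (coord p).2 ≤ 8 := by decide +kernel
  obtain ⟨⟨h₁, h₂⟩, h₃, h₄⟩ := key p hp hp2
  refine ⟨⟨?_, ?_⟩, ?_, ?_⟩ <;> simp only [realCoord] <;> exact_mod_cast ‹_›

theorem seg_subset_box {p q : ℕ} (hp : p < 164) (hq : q < 164) (hadj : q ∈ nbr p) (hpq : p < q)
    (hp2 : 2 ≤ p) : seg (realCoord p) (realCoord q) ⊆ box (gadget q) := by
  have hgad := (eq_vert_of_edge p hp q hadj hpq).2.2.2.2.2.2 hp2
  exact ((convex_Icc _ _).prod (convex_Icc _ _)).segment_subset (hgad ▸ realCoord_mem_box hp hp2)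
    (realCoord_mem_box hq (hp2.trans hpq.le))

theorem mem_box_of_mem_seg {p q : ℕ} (hp : p < 164) (hq : q < 164) (hadj : q ∈ nbr p) (hpq : p < q)
    {z : ℝ × ℝ} (hz : z ∈ seg (realCoord p) (realCoord q)) (hy : z.2 ∈ Icc (-8 : ℝ) 8) :
    z ∈ box (gadget q) := by
  rcases le_or_gt 2 p with hp2 | hp2
  · exact seg_subset_box hp hq hadj hpq hp2 hz
  have hq2 : ∀ p < 2, ∀ q ∈ nbr p, 2 ≤ q := by decide +kernel
  have hq0 : ∀ q ∈ nbr 0, (coord q).2 = 8 := by decide +kernel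
  have hq1 : ∀ q ∈ nbr 1, (coord q).2 = -8 := by decide +kernel
  have hbox := realCoord_mem_box hq (hq2 p hp2 q hadj)
  obtain ⟨s, t, hs, -, hst, rfl⟩ := hz
  obtain ⟨hy₁, hy₂⟩ := hy
  obtain rfl : t = 1 - s := by linarith
  suffices s = 0 by simpa [this] using hbox
  interval_cases p
  · have h0 : (coord 0).2 = 5000 := by decide +kernel
    simp [realCoord, hq0 q hadj, h0] at hy₂
    linarith
  · have h1 : (coord 1).2 = -5000 := by decide +kernel
    simp [realCoord, hq1 q hadj, h1] at hy₁
    linarith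

theorem edges_meet_realCoord {a b c d : Fin 164} (hab : gadgetGraph.Adj a b)
    (hcd : gadgetGraph.Adj c d) (hne : s(a, b) ≠ s(c, d)) :
    seg (realCoord a) (realCoord b) ∩ seg (realCoord c) (realCoord d) ⊆
      ({realCoord a, realCoord b} ∩ {realCoord c, realCoord d} : Set (ℝ × ℝ)) := by
  wlog hab' : a < b generalizing a b
  · rw [seg_comm, Set.pair_comm]
    exact this hab.symm (by rwa [Sym2.eq_swap]) (lt_of_le_of_ne (not_lt.1 hab') hab.ne')
  wlog hcd' : c < d generalizing c d
  · rw [seg_comm (realCoord c), Set.pair_comm (realCoord c)]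
    exact this hcd.symm (by rwa [Sym2.eq_swap (a := d)])
      (lt_of_le_of_ne (not_lt.1 hcd') hcd.ne')
  wlog hac : a ≤ c generalizing a b c d
  · rw [Set.inter_comm, Set.inter_comm {_, _}]
    exact this hcd hcd' hab hne.symm hab' (not_le.1 hac).le
  have hne' : a.val = c → b.val ≠ d := fun h₁ h₂ => hne (by rw [Fin.ext h₁, Fin.ext h₂])
  obtain ⟨ha, hb, hi, hj, hjj, hlt, -⟩ := eq_vert_of_edge a a.isLt b hab hab'
  obtain ⟨hc, hd, -, hk, hkk, hlt', -⟩ := eq_vert_of_edge c c.isLt d hcd hcd'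
  rcases eq_or_ne (gadget b) (gadget d) with hgad | hgad
  · rw [← hgad] at hc hd
    have hle : role a ≤ role c := by
      have : vert (gadget b) (role a) ≤ vert (gadget b) (role c) := ha ▸ hc ▸ hac
      unfold vert at this
      split_ifs at this <;> omega
    have := meetOnlyInEnds_of_gadget _ hi _ hj _ hjj hlt _ hk hle _ hkk hlt'
      fun h₁ h₂ => hne' (by rw [ha, hc, h₁]) (by rw [hb, hd, h₂])
    rw [← ha, ← hb, ← hc, ← hd] at this
    exact this.inter_subset
  rcases lt_or_ge c.val 2 with hc2 | hc2
  · exact (meetOnlyInEnds_of_poles a (lt_of_le_of_lt hac hc2) b hab c hc2 hac d hcd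
      fun h => hgad (by rw [h])).inter_subset
  · rintro z ⟨hz, hz'⟩
    have hbox := seg_subset_box c.isLt d.isLt hcd hcd' hc2 hz'
    exact absurd (eq_of_mem_box (mem_box_of_mem_seg a.isLt b.isLt hab hab' hz hbox.2) hbox) hgad

theorem exists_adj (v : Fin 164) : ∃ w, gadgetGraph.Adj v w := by
  have key : ∀ p < 164, ∃ q ∈ nbr p, q < 164 := by decide +kernel
  obtain ⟨q, hq, hlt⟩ := key v v.isLt
  exact ⟨⟨q, hlt⟩, hq⟩

theorem isPlanar_gadgetGraph : IsPlanar gadgetGraph := by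
  have inj : Function.Injective fun p : Fin 164 => realCoord p :=
    fun p q h => Fin.ext (realCoord_injective p.isLt q.isLt h)
  refine ⟨⟨fun p => realCoord p, inj, fun a b c d => edges_meet_realCoord, ?_⟩⟩
  intro a b v hab hva hvb hmem
  obtain ⟨w, hvw⟩ := exists_adj v
  have hne : s(a, b) ≠ s(v, w) := by
    intro h
    have : v ∈ s(a, b) := h ▸ Sym2.mem_mk_left v w
    simp [hva, hvb] at this
  rcases (edges_meet_realCoord hab hvw hne ⟨hmem, left_mem_segment ℝ _ _⟩).1 with h | h
  · exact hva (inj h)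
  · exact hvb (inj h)

/-- There exists a planar graph with no cycle of length 4 and no cycle of length 5
that is not `(3,2)`-choosable. -/
theorem exists_planar_C4C5free_not_choosable_3_2 :
    ∃ (n : ℕ) (G : SimpleGraph (Fin n)),
      IsPlanar G ∧ ¬ HasCycleLen G 4 ∧ ¬ HasCycleLen G 5 ∧ ¬ Choosable G 3 2 := by
  exact ⟨164, gadgetGraph, isPlanar_gadgetGraph, not_hasCycleLen_four, not_hasCycleLen_five,
    not_choosable⟩

end ChoosSep
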